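/- arXiv:2503.21550 — 2 statements merged into one kernel-verified Lean document; each statement's English description precedes it below -/
import Mathlib

section
/- The set B = {φ₁+φ₂+2φ₃+φ₄, −(φ₁+2φ₂+2φ₃), −(φ₁+φ₂+φ₃+φ₄), φ₂} is a base of Δ, and the positive system determined by B equals Δ_k⁺ ∪ {β ∈ Δ_n⁺ : β ≥ φ₁+φ₂+2φ₃+φ₄} ∪ (−{β ∈ Δ_n⁺ : β ≤ φ₁+2φ₂+2φ₃ or β ≤ φ₁+φ₂+φ₃+φ₄}); in particular this positive system contains Δ_k⁺. -/
noncomputable section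

abbrev V : Type := Fin 4 → ℝ

def e (i : Fin 4) : V := Pi.single i 1

/-- The root system of type F₄ in ℝ⁴ (48 vectors). -/
def Δ : Set V :=
  (⋃ i, ({e i, -e i} : Set V)) ∪
  (⋃ (i) (j) (_ : i < j), ({e i + e j, e i - e j, -e i + e j, -e i - e j} : Set V)) ∪
  {v | ∃ s : Fin 4 → ℝ, (∀ i, s i = 1 ∨ s i = -1) ∧ v = (1 / 2 : ℝ) • ∑ i, s i • e i}

def φ₁ : V := e 1 - e 2
def φ₂ : V := e 2 - e 3
def φ₃ : V := e 3
def φ₄ : V := (1 / 2 : ℝ) • (e 0 - e 1 - e 2 - e 3)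

def φv : Fin 4 → V := ![φ₁, φ₂, φ₃, φ₄]

/-- The coordinates `n₁(α), …, n₄(α)` of `α` with respect to the basis φ₁,…,φ₄:
for every `α : V` one has `α = ∑ i, n α i • φv i`. -/
def n (α : V) : Fin 4 → ℝ :=
  ![α 1 + α 0, α 1 + α 2 + 2 * α 0, α 1 + α 2 + α 3 + 3 * α 0, 2 * α 0]

/-- The highest root δ = 2φ₁+3φ₂+4φ₃+2φ₄ = e₁+e₂. -/
def δ : V := e 0 + e 1

/-- Compact roots: roots α with n₁(α) even. -/
def Δk : Set V := {α ∈ Δ | ∃ m : ℤ, n α 0 = 2 * m}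

/-- Noncompact roots: roots α with n₁(α) odd. -/
def Δn : Set V := {α ∈ Δ | ∃ m : ℤ, n α 0 = 2 * m + 1}

/-- Δ⁺: roots with all φ-coefficients nonnegative. -/
def Δp : Set V := {α ∈ Δ | ∀ i, 0 ≤ n α i}

def Δkp : Set V := Δp ∩ Δk
def Δnp : Set V := Δp ∩ Δn

/-- A positive system of Δ: the set of roots on which some root-regular linear
functional is positive. -/
def IsPosSystem (P : Set V) : Prop :=
  ∃ f : V →ₗ[ℝ] ℝ, (∀ α ∈ Δ, f α ≠ 0) ∧ P = {α ∈ Δ | 0 < f α}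

/-- `le' γ β` means γ ≤ β, i.e. β − γ is a nonnegative integer combination of φ₁,…,φ₄. -/
def le' (γ β : V) : Prop := ∃ c : Fin 4 → ℕ, β - γ = ∑ i, (c i : ℝ) • φv i

/-- A base of Δ: a linearly independent subset of Δ such that every root is an
integral combination with coefficients all ≥ 0 or all ≤ 0. -/
def IsBase (B : Finset V) : Prop :=
  ↑B ⊆ Δ ∧ LinearIndependent ℝ (Subtype.val : {x : V // x ∈ B} → V) ∧
  ∀ α ∈ Δ, ∃ c : V → ℤ,
    α = ∑ x ∈ B, (c x : ℝ) • x ∧ ((∀ x ∈ B, 0 ≤ c x) ∨ (∀ x ∈ B, c x ≤ 0))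

/-- The positive system determined by a base B: roots whose B-coefficients are all ≥ 0. -/
def posOf (B : Finset V) : Set V :=
  {α ∈ Δ | ∃ c : V → ℤ, α = ∑ x ∈ B, (c x : ℝ) • x ∧ ∀ x ∈ B, 0 ≤ c x}

/-- The lattice vector with integer coordinates `a` in the basis `φ₁, …, φ₄`. -/
def latticeVec (a : Fin 4 → ℤ) : V := ∑ i, (a i : ℝ) • φv i

/-- Twice the standard coordinates of `latticeVec a`. -/
def doubleCoord (a : Fin 4 → ℤ) : Fin 4 → ℤ :=
  ![a 3, 2 * a 0 - a 3, 2 * (a 1 - a 0) - a 3, 2 * (a 2 - a 1) - a 3]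

lemma latticeVec_apply (a : Fin 4 → ℤ) (i : Fin 4) :
    latticeVec a i = (doubleCoord a i : ℝ) / 2 := by
  fin_cases i <;>
    simp [latticeVec, doubleCoord, Fin.sum_univ_four, φv, φ₁, φ₂, φ₃, φ₄, e] <;>
    ring

lemma n_latticeVec (a : Fin 4 → ℤ) (i : Fin 4) : n (latticeVec a) i = a i := by
  fin_cases i <;> simp [n, latticeVec_apply, doubleCoord] <;> ring

lemma latticeVec_injective : Function.Injective latticeVec := fun a b h => by
  funext i
  have := n_latticeVec a i
  rw [h, n_latticeVec] at this
  exact_mod_cast this.symm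

lemma latticeVec_neg (a : Fin 4 → ℤ) : latticeVec (-a) = -latticeVec a := by
  simp [latticeVec]

lemma latticeVec_sub (a b : Fin 4 → ℤ) : latticeVec (a - b) = latticeVec a - latticeVec b := by
  simp [latticeVec, sub_smul]

lemma sum_smul_latticeVec {ι : Type*} (s : Finset ι) (d : ι → ℤ) (a : ι → Fin 4 → ℤ) :
    ∑ i ∈ s, (d i : ℝ) • latticeVec (a i) = latticeVec (∑ i ∈ s, d i • a i) := by
  simp only [latticeVec, Finset.smul_sum, smul_smul, Finset.sum_apply, Pi.smul_apply, smul_eq_mul,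
    Int.cast_sum, Int.cast_mul, Finset.sum_smul]
  exact Finset.sum_comm

lemma le'_latticeVec (a b : Fin 4 → ℤ) : le' (latticeVec a) (latticeVec b) ↔ a ≤ b := by
  constructor
  · rintro ⟨c, hc⟩ i
    have h : latticeVec (b - a) = latticeVec fun i => (c i : ℤ) := by
      rw [latticeVec_sub, hc]
      simp [latticeVec]
    have hi : b i - a i = c i := congrFun (latticeVec_injective h) i
    exact sub_nonneg.1 (hi ▸ Int.natCast_nonneg (c i))
  · intro h
    refine ⟨fun i => (b i - a i).toNat, ?_⟩
    have key : ∀ i, (((b i - a i).toNat : ℕ) : ℝ) = ((b i - a i : ℤ) : ℝ) := fun i => by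
      exact_mod_cast Int.toNat_of_nonneg (sub_nonneg.2 (h i))
    rw [← latticeVec_sub]
    simp only [key]
    rfl

/-- The `φ`-coordinates of the positive roots. -/
def posRootCoords : Finset (Fin 4 → ℤ) :=
  {![1, 0, 0, 0], ![0, 1, 0, 0], ![0, 0, 1, 0], ![0, 0, 0, 1],
   ![1, 1, 0, 0], ![0, 1, 1, 0], ![0, 0, 1, 1], ![1, 1, 1, 0],
   ![0, 1, 2, 0], ![0, 1, 1, 1], ![1, 1, 2, 0], ![1, 1, 1, 1],
   ![0, 1, 2, 1], ![1, 2, 2, 0], ![1, 1, 2, 1], ![0, 1, 2, 2],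
   ![1, 2, 2, 1], ![1, 1, 2, 2], ![1, 2, 3, 1], ![1, 2, 2, 2],
   ![1, 2, 3, 2], ![1, 2, 4, 2], ![1, 3, 4, 2], ![2, 3, 4, 2]}

/-- The `φ`-coordinates of the roots. -/
def rootCoords : Finset (Fin 4 → ℤ) := posRootCoords ∪ posRootCoords.image Neg.neg

lemma exists_rootCoords_of_double {α : V} {z : Fin 4 → ℤ} (hz : z ∈ rootCoords.image doubleCoord)
    (hα : ∀ i, α i = (z i : ℝ) / 2) : ∃ a ∈ rootCoords, α = latticeVec a := by
  obtain ⟨a, ha, rfl⟩ := Finset.mem_image.1 hz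
  exact ⟨a, ha, funext fun i => by rw [hα, latticeVec_apply]⟩

set_option maxRecDepth 100000 in
lemma single_mem_double : ∀ i : Fin 4, ∀ s ∈ ({1, -1} : Finset ℤ),
    Pi.single i (2 * s) ∈ rootCoords.image doubleCoord := by
  decide

set_option maxRecDepth 100000 in
lemma single_add_single_mem_double : ∀ i j : Fin 4, i < j → ∀ s ∈ ({1, -1} : Finset ℤ),
    ∀ t ∈ ({1, -1} : Finset ℤ),
    Pi.single i (2 * s) + Pi.single j (2 * t) ∈ rootCoords.image doubleCoord := by
  decide

set_option maxRecDepth 100000 in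
lemma signs_mem_double : ∀ s ∈ ({1, -1} : Finset ℤ), ∀ t ∈ ({1, -1} : Finset ℤ),
    ∀ u ∈ ({1, -1} : Finset ℤ), ∀ v ∈ ({1, -1} : Finset ℤ),
    ![s, t, u, v] ∈ rootCoords.image doubleCoord := by
  decide

lemma exists_rootCoords {α : V} (hα : α ∈ Δ) : ∃ a ∈ rootCoords, α = latticeVec a := by
  rcases hα with (hα | hα) | ⟨s, hs, rfl⟩
  · obtain ⟨i, hi⟩ := Set.mem_iUnion.1 hα
    have of_sign (s : ℤ) (hs : s ∈ ({1, -1} : Finset ℤ)) (h : α = (s : ℝ) • e i) :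
        ∃ a ∈ rootCoords, α = latticeVec a :=
      exists_rootCoords_of_double (single_mem_double i s hs) fun k => by
        by_cases hk : k = i <;> simp [h, e, hk]
    rcases hi with rfl | rfl
    · exact of_sign 1 (by simp) (by simp)
    · exact of_sign (-1) (by simp) (by simp)
  · simp only [Set.mem_iUnion] at hα
    obtain ⟨i, j, hij, h⟩ := hα
    have of_signs (s t : ℤ) (hs : s ∈ ({1, -1} : Finset ℤ)) (ht : t ∈ ({1, -1} : Finset ℤ))
        (h : α = (s : ℝ) • e i + (t : ℝ) • e j) : ∃ a ∈ rootCoords, α = latticeVec a :=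
      exists_rootCoords_of_double (single_add_single_mem_double i j hij s hs t ht) fun k => by
        simp only [h, e, Pi.add_apply, Pi.smul_apply, Pi.single_apply, smul_eq_mul]
        split_ifs <;> push_cast <;> ring
    rcases h with rfl | rfl | rfl | rfl
    · exact of_signs 1 1 (by simp) (by simp) (by simp)
    · exact of_signs 1 (-1) (by simp) (by simp) (by simp [sub_eq_add_neg])
    · exact of_signs (-1) 1 (by simp) (by simp) (by simp)
    · exact of_signs (-1) (-1) (by simp) (by simp) (by simp [sub_eq_add_neg])
  · have hs' (i) : ∃ t ∈ ({1, -1} : Finset ℤ), s i = t := by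
      rcases hs i with h | h
      · exact ⟨1, by simp, by simp [h]⟩
      · exact ⟨-1, by simp, by simp [h]⟩
    choose t ht hst using hs'
    refine exists_rootCoords_of_double
      (signs_mem_double _ (ht 0) _ (ht 1) _ (ht 2) _ (ht 3)) fun k => ?_
    fin_cases k <;> simp [Fin.sum_univ_four, e, hst] <;> ring

lemma neg_mem_Δ {α : V} (hα : α ∈ Δ) : -α ∈ Δ := by
  rcases hα with (hα | hα) | ⟨s, hs, rfl⟩
  · refine Or.inl (Or.inl ?_)
    obtain ⟨i, hi⟩ := Set.mem_iUnion.1 hα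
    refine Set.mem_iUnion.2 ⟨i, ?_⟩
    rcases hi with rfl | rfl <;> simp
  · refine Or.inl (Or.inr ?_)
    simp only [Set.mem_iUnion] at hα ⊢
    obtain ⟨i, j, hij, h⟩ := hα
    refine ⟨i, j, hij, ?_⟩
    rcases h with rfl | rfl | rfl | rfl
    · exact Or.inr (Or.inr (Or.inr (by simp only [Set.mem_singleton_iff]; abel)))
    · exact Or.inr (Or.inr (Or.inl (by abel)))
    · exact Or.inr (Or.inl (by abel))
    · exact Or.inl (by abel)
  · refine Or.inr ⟨-s, fun i => ?_, by simp⟩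
    rcases hs i with h | h <;> simp [h]

/-- The `φ`-coordinates of the elements of the base. -/
def baseCoords : Fin 4 → Fin 4 → ℤ :=
  ![![1, 1, 2, 1], ![-1, -2, -2, 0], ![-1, -1, -1, -1], ![0, 1, 0, 0]]

/-- The elements of the base. -/
def baseVec (i : Fin 4) : V := latticeVec (baseCoords i)

/-- Coordinates with respect to the base, in terms of those with respect to the `φᵢ`. -/
def baseRepr (a : Fin 4 → ℤ) : Fin 4 → ℤ :=
  ![a 2 + a 3 - 2 * a 0, a 3 - a 0, a 2 - 2 * a 0, a 1 + a 3 - 2 * a 0]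

lemma latticeVec_eq_sum_baseVec_iff (a d : Fin 4 → ℤ) :
    latticeVec a = ∑ i, (d i : ℝ) • baseVec i ↔ d = baseRepr a := by
  simp only [baseVec, sum_smul_latticeVec, latticeVec_injective.eq_iff, funext_iff,
    Fin.forall_fin_succ, Fin.sum_univ_four, baseCoords, baseRepr]
  simp
  omega

lemma linearIndependent_baseVec : LinearIndependent ℝ baseVec := by
  rw [Fintype.linearIndependent_iff]
  intro g hg
  have h (k : Fin 4) := congrFun hg k
  simp only [Finset.sum_apply, Pi.smul_apply, baseVec, latticeVec_apply, Fin.sum_univ_four] at h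
  have h0 := h 0
  have h1 := h 1
  have h2 := h 2
  have h3 := h 3
  simp [baseCoords, doubleCoord] at h0 h1 h2 h3
  intro i
  fin_cases i <;> simp <;> linarith

lemma baseVec_mem_Δ (i : Fin 4) : baseVec i ∈ Δ := by
  have ext_double {α : V} (a : Fin 4 → ℤ) (h : ∀ k, α k = (doubleCoord a k : ℝ) / 2) :
      latticeVec a = α := funext fun k => by rw [latticeVec_apply, h]
  fin_cases i
  · refine Or.inr ⟨![1, 1, -1, 1], fun i => by fin_cases i <;> simp, ext_double _ fun k => ?_⟩
    fin_cases k <;>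
      simp [baseCoords, doubleCoord, Fin.sum_univ_four, e] <;> norm_num
  · refine Or.inl (Or.inr ?_)
    simp only [Set.mem_iUnion]
    refine ⟨1, 2, by decide, Or.inr (Or.inr (Or.inr (ext_double _ fun k => ?_)))⟩
    fin_cases k <;> simp [baseCoords, doubleCoord, e]
  · refine Or.inr ⟨![-1, -1, 1, 1], fun i => by fin_cases i <;> simp, ext_double _ fun k => ?_⟩
    fin_cases k <;>
      simp [baseCoords, doubleCoord, Fin.sum_univ_four, e] <;> norm_num
  · refine Or.inl (Or.inr ?_)
    simp only [Set.mem_iUnion]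
    refine ⟨2, 3, by decide, Or.inr (Or.inl (ext_double _ fun k => ?_))⟩
    fin_cases k <;> simp [baseCoords, doubleCoord, e]

lemma base_eq_image :
    ({φ₁ + φ₂ + (2 : ℝ) • φ₃ + φ₄, -(φ₁ + (2 : ℝ) • φ₂ + (2 : ℝ) • φ₃),
      -(φ₁ + φ₂ + φ₃ + φ₄), φ₂} : Finset V) = Finset.univ.image baseVec := by
  have h0 : baseVec 0 = φ₁ + φ₂ + (2 : ℝ) • φ₃ + φ₄ := by
    simp [baseVec, latticeVec, baseCoords, Fin.sum_univ_four, φv]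
  have h1 : baseVec 1 = -(φ₁ + (2 : ℝ) • φ₂ + (2 : ℝ) • φ₃) := by
    simp [baseVec, latticeVec, baseCoords, Fin.sum_univ_four, φv]
    abel
  have h2 : baseVec 2 = -(φ₁ + φ₂ + φ₃ + φ₄) := by
    simp [baseVec, latticeVec, baseCoords, Fin.sum_univ_four, φv]
    abel
  have h3 : baseVec 3 = φ₂ := by
    simp [baseVec, latticeVec, baseCoords, Fin.sum_univ_four, φv]
  ext x
  simp only [Finset.mem_insert, Finset.mem_singleton, Finset.mem_image, Finset.mem_univ, true_and,
    Fin.exists_fin_succ]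
  simp [h0, h1, h2, h3, eq_comm]

lemma sum_image_baseVec (c : V → ℤ) :
    ∑ x ∈ Finset.univ.image baseVec, (c x : ℝ) • x = ∑ i, (c (baseVec i) : ℝ) • baseVec i :=
  Finset.sum_image fun _ _ _ _ h => linearIndependent_baseVec.injective h

lemma exists_comp_baseVec (d : Fin 4 → ℤ) : ∃ c : V → ℤ, ∀ i, c (baseVec i) = d i :=
  ⟨Function.extend baseVec d 0, fun i => linearIndependent_baseVec.injective.extend_apply d 0 i⟩

set_option maxRecDepth 100000 in
lemma baseRepr_nonneg_or_nonpos : ∀ a ∈ rootCoords,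
    (∀ i, 0 ≤ baseRepr a i) ∨ (∀ i, baseRepr a i ≤ 0) := by
  decide

set_option maxRecDepth 100000 in
lemma baseRepr_nonneg_iff : ∀ a ∈ rootCoords, (∀ i, 0 ≤ baseRepr a i) ↔
    (((∀ i, 0 ≤ a i) ∧ Even (a 0)) ∨ ((∀ i, 0 ≤ a i) ∧ Odd (a 0)) ∧ ![1, 1, 2, 1] ≤ a) ∨
      ((∀ i, 0 ≤ (-a) i) ∧ Odd ((-a) 0)) ∧ (-a ≤ ![1, 2, 2, 0] ∨ -a ≤ ![1, 1, 1, 1]) := by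
  simp only [Pi.le_def]
  decide

lemma isBase_image_baseVec : IsBase (Finset.univ.image baseVec) := by
  refine ⟨?_, ?_, fun α hα => ?_⟩
  · simpa [Set.range_subset_iff] using baseVec_mem_Δ
  · have h := linearIndependent_baseVec.linearIndepOn_id
    rw [← Set.image_univ, ← Finset.coe_univ, ← Finset.coe_image] at h
    exact h
  · obtain ⟨a, ha, rfl⟩ := exists_rootCoords hα
    obtain ⟨c, hc⟩ := exists_comp_baseVec (baseRepr a)
    refine ⟨c, ?_, ?_⟩
    · simpa only [sum_image_baseVec, hc] using (latticeVec_eq_sum_baseVec_iff a _).2 rfl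
    · simpa [hc] using baseRepr_nonneg_or_nonpos a ha

lemma latticeVec_mem_posOf_iff {a : Fin 4 → ℤ} (ha : latticeVec a ∈ Δ) :
    latticeVec a ∈ posOf (Finset.univ.image baseVec) ↔ ∀ i, 0 ≤ baseRepr a i := by
  constructor
  · rintro ⟨-, c, hc, hpos⟩ i
    rw [sum_image_baseVec] at hc
    rw [← (latticeVec_eq_sum_baseVec_iff a fun i => c (baseVec i)).1 hc]
    exact hpos _ (by simp)
  · intro h
    obtain ⟨c, hc⟩ := exists_comp_baseVec (baseRepr a)
    refine ⟨ha, c, ?_, by simpa [hc] using h⟩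
    simpa only [sum_image_baseVec, hc] using (latticeVec_eq_sum_baseVec_iff a _).2 rfl

lemma latticeVec_mem_Δkp_iff {a : Fin 4 → ℤ} (ha : latticeVec a ∈ Δ) :
    latticeVec a ∈ Δkp ↔ (∀ i, 0 ≤ a i) ∧ Even (a 0) := by
  simp only [Δkp, Δp, Δk, Set.mem_inter_iff, Set.mem_ofPred_eq, ha, true_and, n_latticeVec,
    Int.cast_nonneg_iff, even_iff_exists_two_mul]
  norm_cast

lemma latticeVec_mem_Δnp_iff {a : Fin 4 → ℤ} (ha : latticeVec a ∈ Δ) :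
    latticeVec a ∈ Δnp ↔ (∀ i, 0 ≤ a i) ∧ Odd (a 0) := by
  simp only [Δnp, Δp, Δn, Set.mem_inter_iff, Set.mem_ofPred_eq, ha, true_and, n_latticeVec,
    Int.cast_nonneg_iff, Odd]
  norm_cast

lemma posOf_image_baseVec : posOf (Finset.univ.image baseVec) =
    Δkp ∪ {β ∈ Δnp | le' (φ₁ + φ₂ + (2 : ℝ) • φ₃ + φ₄) β} ∪
      (Neg.neg '' {β ∈ Δnp | le' β (φ₁ + (2 : ℝ) • φ₂ + (2 : ℝ) • φ₃) ∨
        le' β (φ₁ + φ₂ + φ₃ + φ₄)}) := by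
  have h1 : φ₁ + φ₂ + (2 : ℝ) • φ₃ + φ₄ = latticeVec ![1, 1, 2, 1] := by
    simp [latticeVec, Fin.sum_univ_four, φv]
  have h2 : φ₁ + (2 : ℝ) • φ₂ + (2 : ℝ) • φ₃ = latticeVec ![1, 2, 2, 0] := by
    simp [latticeVec, Fin.sum_univ_four, φv]
  have h3 : φ₁ + φ₂ + φ₃ + φ₄ = latticeVec ![1, 1, 1, 1] := by
    simp [latticeVec, Fin.sum_univ_four, φv]
  rw [h1, h2, h3, Set.image_neg_eq_neg]
  ext α
  by_cases hα : α ∈ Δ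
  · obtain ⟨a, ha, rfl⟩ := exists_rootCoords hα
    have hα' : latticeVec (-a) ∈ Δ := latticeVec_neg a ▸ neg_mem_Δ hα
    rw [latticeVec_mem_posOf_iff hα, baseRepr_nonneg_iff a ha]
    simp only [Set.mem_union, Set.mem_neg, Set.mem_ofPred_eq, ← latticeVec_neg,
      latticeVec_mem_Δkp_iff hα, latticeVec_mem_Δnp_iff hα, latticeVec_mem_Δnp_iff hα',
      le'_latticeVec]
  · refine iff_of_false (fun h => hα h.1) ?_
    rintro ((h | h) | h)
    · exact hα h.1.1
    · exact hα h.1.1.1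
    · exact hα (neg_neg α ▸ neg_mem_Δ h.1.1.1)

theorem stmt14 :
    IsBase ({φ₁ + φ₂ + (2 : ℝ) • φ₃ + φ₄, -(φ₁ + (2 : ℝ) • φ₂ + (2 : ℝ) • φ₃), -(φ₁ + φ₂ + φ₃ + φ₄), φ₂} : Finset V) ∧
    posOf ({φ₁ + φ₂ + (2 : ℝ) • φ₃ + φ₄, -(φ₁ + (2 : ℝ) • φ₂ + (2 : ℝ) • φ₃), -(φ₁ + φ₂ + φ₃ + φ₄), φ₂} : Finset V) =
      Δkp ∪ {β ∈ Δnp | le' (φ₁ + φ₂ + (2 : ℝ) • φ₃ + φ₄) β} ∪ (Neg.neg '' {β ∈ Δnp | le' β (φ₁ + (2 : ℝ) • φ₂ + (2 : ℝ) • φ₃) ∨ le' β (φ₁ + φ₂ + φ₃ + φ₄)}) ∧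
    Δkp ⊆ posOf ({φ₁ + φ₂ + (2 : ℝ) • φ₃ + φ₄, -(φ₁ + (2 : ℝ) • φ₂ + (2 : ℝ) • φ₃), -(φ₁ + φ₂ + φ₃ + φ₄), φ₂} : Finset V) := by
  rw [base_eq_image, posOf_image_baseVec]
  exact ⟨isBase_image_baseVec, rfl, fun α h => Or.inl (Or.inl h)⟩
end
end

section
/- Among the distinct sets of the form S(B,Γ), as B ranges over all bases of Δ whose determined positive system contains Δ_k⁺ and Γ ranges over all subsets of B, exactly 12 sets S have the property that Δ_k⁺ ∪ S is a positive system of Δ; these are precisely the sets P ∩ Δ_n as P ranges over the positive systems of Δ containing Δ_k⁺. -/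
noncomputable section

/-- `SBG B Γ` is the set of noncompact roots whose expansion over the base `B` has a
positive coefficient on some element of `Γ`. -/
def SBG (B Γ : Finset V) : Set V :=
  {β ∈ Δn | ∃ c : V → ℤ, β = ∑ x ∈ B, (c x : ℝ) • x ∧ ∃ x ∈ Γ, 0 < c x}

namespace F4

/-! ### Roots in integer coordinates with respect to `φv` -/

/-- The coordinate vectors of the positive roots with respect to the basis `φv`. -/
def positiveCoords : Finset (Fin 4 → ℤ) :=
  {![1, 0, 0, 0], ![0, 1, 0, 0], ![0, 0, 1, 0], ![0, 0, 0, 1],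
    ![1, 1, 0, 0], ![0, 1, 1, 0], ![0, 0, 1, 1], ![1, 1, 1, 0],
    ![0, 1, 2, 0], ![0, 1, 1, 1], ![1, 1, 2, 0], ![1, 1, 1, 1],
    ![0, 1, 2, 1], ![1, 2, 2, 0], ![1, 1, 2, 1], ![0, 1, 2, 2],
    ![1, 2, 2, 1], ![1, 1, 2, 2], ![1, 2, 3, 1], ![1, 2, 2, 2],
    ![1, 2, 3, 2], ![1, 2, 4, 2], ![1, 3, 4, 2], ![2, 3, 4, 2]}

/-- The coordinate vectors of all roots with respect to the basis `φv`. -/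
def rootCoords : Finset (Fin 4 → ℤ) :=
  positiveCoords ∪ positiveCoords.image (fun r => -r)

/-- The vector of `V` with the given integer coordinates with respect to `φv`. -/
def ofCoords (r : Fin 4 → ℤ) : V := ∑ i, (r i : ℝ) • φv i

/-- Twice the standard coordinates of `ofCoords r`. -/
def doubled (r : Fin 4 → ℤ) : Fin 4 → ℤ :=
  ![r 3, 2 * r 0 - r 3, 2 * r 1 - 2 * r 0 - r 3, 2 * r 2 - 2 * r 1 - r 3]

lemma ofCoords_apply (r : Fin 4 → ℤ) (i : Fin 4) : ofCoords r i = (doubled r i : ℝ) / 2 := by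
  fin_cases i <;>
    simp [ofCoords, doubled, Fin.sum_univ_four, φv, φ₁, φ₂, φ₃, φ₄, e] <;> ring

lemma n_ofCoords (r : Fin 4 → ℤ) (i : Fin 4) : n (ofCoords r) i = r i := by
  fin_cases i <;> simp [n, ofCoords_apply, doubled] <;> ring

lemma ofCoords_injective : Function.Injective ofCoords := fun r s h => by
  ext i
  have := congrArg (fun v => n v i) h
  simpa [n_ofCoords] using this

lemma eq_ofCoords {v : V} {r : Fin 4 → ℤ} (h : ∀ i, v i = (doubled r i : ℝ) / 2) :
    v = ofCoords r := by
  ext i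
  rw [h, ofCoords_apply]

lemma exists_coords_single : ∀ i : Fin 4, ∀ s : ℤˣ, ∃ r ∈ rootCoords,
    doubled r = Pi.single i (2 * (s : ℤ)) := by decide +kernel

lemma exists_coords_pair : ∀ i j : Fin 4, i < j → ∀ s t : ℤˣ, ∃ r ∈ rootCoords,
    doubled r = Pi.single i (2 * (s : ℤ)) + Pi.single j (2 * (t : ℤ)) := by decide +kernel

lemma exists_coords_half : ∀ s : Fin 4 → ℤˣ, ∃ r ∈ rootCoords,
    doubled r = fun i => (s i : ℤ) := by decide +kernel

lemma doubled_cases : ∀ r ∈ rootCoords,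
    (∃ i : Fin 4, ∃ s : ℤˣ, doubled r = Pi.single i (2 * (s : ℤ))) ∨
    (∃ i j : Fin 4, i < j ∧ ∃ s t : ℤˣ,
      doubled r = Pi.single i (2 * (s : ℤ)) + Pi.single j (2 * (t : ℤ))) ∨
    ∃ s : Fin 4 → ℤˣ, doubled r = fun i => (s i : ℤ) := by decide +kernel

lemma smul_e_eq_ofCoords {r : Fin 4 → ℤ} {i : Fin 4} {s : ℤˣ}
    (h : doubled r = Pi.single i (2 * (s : ℤ))) : ((s : ℤ) : ℝ) • e i = ofCoords r :=
  eq_ofCoords fun k => by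
    rw [h]
    by_cases hk : k = i <;> simp [e, hk]

lemma smul_e_add_eq_ofCoords {r : Fin 4 → ℤ} {i j : Fin 4} {s t : ℤˣ}
    (h : doubled r = Pi.single i (2 * (s : ℤ)) + Pi.single j (2 * (t : ℤ))) :
    ((s : ℤ) : ℝ) • e i + ((t : ℤ) : ℝ) • e j = ofCoords r :=
  eq_ofCoords fun k => by
    rw [h]
    by_cases hi : k = i <;> by_cases hj : k = j <;> subst_vars <;> simp_all [e]
    ring

lemma half_sum_eq_ofCoords {r : Fin 4 → ℤ} {s : Fin 4 → ℤˣ}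
    (h : doubled r = fun i => (s i : ℤ)) :
    (1 / 2 : ℝ) • ∑ i, ((s i : ℤ) : ℝ) • e i = ofCoords r :=
  eq_ofCoords fun k => by
    rw [h]
    simp [e, Finset.sum_apply, Pi.single_apply]
    ring

lemma Δ_eq_image : Δ = ofCoords '' rootCoords := by
  ext v
  constructor
  · rintro ((hv | hv) | ⟨s, hs, rfl⟩)
    · obtain ⟨i, hv⟩ := Set.mem_iUnion.1 hv
      have key (s : ℤˣ) : ((s : ℤ) : ℝ) • e i ∈ ofCoords '' rootCoords := by
        obtain ⟨r, hr, h⟩ := exists_coords_single i s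
        exact ⟨r, hr, (smul_e_eq_ofCoords h).symm⟩
      rcases hv with rfl | rfl
      · simpa using key 1
      · simpa using key (-1)
    · simp only [Set.mem_iUnion] at hv
      obtain ⟨i, j, hij, hv⟩ := hv
      have key (s t : ℤˣ) :
          ((s : ℤ) : ℝ) • e i + ((t : ℤ) : ℝ) • e j ∈ ofCoords '' rootCoords := by
        obtain ⟨r, hr, h⟩ := exists_coords_pair i j hij s t
        exact ⟨r, hr, (smul_e_add_eq_ofCoords h).symm⟩
      rcases hv with rfl | rfl | rfl | rfl
      · simpa using key 1 1
      · simpa [sub_eq_add_neg] using key 1 (-1)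
      · simpa using key (-1) 1
      · simpa [sub_eq_add_neg] using key (-1) (-1)
    · have hs' (i : Fin 4) : ∃ t : ℤˣ, s i = ((t : ℤ) : ℝ) := by
        rcases hs i with h | h
        · exact ⟨1, by simp [h]⟩
        · exact ⟨-1, by simp [h]⟩
      choose t ht using hs'
      obtain ⟨r, hr, h⟩ := exists_coords_half t
      refine ⟨r, hr, ?_⟩
      simp only [ht]
      exact (half_sum_eq_ofCoords h).symm
  · rintro ⟨r, hr, rfl⟩
    rcases doubled_cases r hr with ⟨i, s, h⟩ | ⟨i, j, hij, s, t, h⟩ | ⟨s, h⟩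
    · rw [← smul_e_eq_ofCoords h]
      refine Or.inl (Or.inl (Set.mem_iUnion.2 ⟨i, ?_⟩))
      rcases Int.units_eq_one_or s with rfl | rfl <;> simp
    · rw [← smul_e_add_eq_ofCoords h]
      refine Or.inl (Or.inr ?_)
      simp only [Set.mem_iUnion]
      refine ⟨i, j, hij, ?_⟩
      rcases Int.units_eq_one_or s with rfl | rfl <;>
        rcases Int.units_eq_one_or t with rfl | rfl <;> simp [sub_eq_add_neg]
    · rw [← half_sum_eq_ofCoords h]
      refine Or.inr ⟨_, fun i => ?_, rfl⟩
      rcases Int.units_eq_one_or (s i) with h | h <;> simp [h]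

lemma ofCoords_mem_Δ {r : Fin 4 → ℤ} : ofCoords r ∈ Δ ↔ r ∈ rootCoords := by
  rw [Δ_eq_image, ofCoords_injective.mem_set_image, Finset.mem_coe]

lemma ofCoords_mem_Δn {r : Fin 4 → ℤ} : ofCoords r ∈ Δn ↔ r ∈ rootCoords ∧ Odd (r 0) := by
  simp only [Δn, Set.mem_ofPred_eq, ofCoords_mem_Δ, n_ofCoords, Odd]
  norm_cast

lemma ofCoords_mem_Δkp {r : Fin 4 → ℤ} :
    ofCoords r ∈ Δkp ↔ r ∈ rootCoords ∧ (∀ i, 0 ≤ r i) ∧ Even (r 0) := by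
  simp only [Δkp, Δp, Δk, Set.mem_inter_iff, Set.mem_ofPred_eq, ofCoords_mem_Δ, n_ofCoords,
    even_iff_exists_two_mul]
  norm_cast
  tauto

lemma exists_coords {α : V} (hα : α ∈ Δ) : ∃ r ∈ rootCoords, ofCoords r = α := by
  rwa [Δ_eq_image] at hα

/-! ### The twelve bases -/

/-- The coordinates of the members of twelve bases of `Δ`. -/
def simpleCoords : Fin 12 → Fin 4 → Fin 4 → ℤ :=
  ![![![1, 0, 0, 0], ![0, 1, 0, 0], ![0, 0, 1, 0], ![0, 0, 0, 1]],
    ![![-1, 0, 0, 0], ![1, 1, 0, 0], ![0, 0, 1, 0], ![0, 0, 0, 1]],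
    ![![0, 1, 0, 0], ![-1, -1, 0, 0], ![1, 1, 1, 0], ![0, 0, 0, 1]],
    ![![0, 1, 0, 0], ![1, 1, 2, 0], ![-1, -1, -1, 0], ![1, 1, 1, 1]],
    ![![1, 2, 2, 0], ![-1, -1, -2, 0], ![0, 0, 1, 0], ![1, 1, 1, 1]],
    ![![0, 1, 0, 0], ![1, 1, 2, 0], ![0, 0, 0, 1], ![-1, -1, -1, -1]],
    ![![-1, -2, -2, 0], ![0, 1, 0, 0], ![0, 0, 1, 0], ![1, 1, 1, 1]],
    ![![1, 2, 2, 0], ![-1, -1, -2, 0], ![1, 1, 2, 1], ![-1, -1, -1, -1]],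
    ![![-1, -2, -2, 0], ![0, 1, 0, 0], ![1, 1, 2, 1], ![-1, -1, -1, -1]],
    ![![1, 2, 2, 0], ![1, 1, 2, 2], ![-1, -1, -2, -1], ![0, 0, 1, 0]],
    ![![-1, -2, -2, 0], ![2, 3, 4, 2], ![-1, -1, -2, -1], ![0, 0, 1, 0]],
    ![![2, 3, 4, 2], ![-1, -1, -2, -2], ![0, 0, 0, 1], ![0, 0, 1, 0]]]

/-- The dual bases of the bases `simpleCoords k`. -/
def dualCoords : Fin 12 → Fin 4 → Fin 4 → ℤ :=
  ![![![1, 0, 0, 0], ![0, 1, 0, 0], ![0, 0, 1, 0], ![0, 0, 0, 1]],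
    ![![-1, 1, 0, 0], ![0, 1, 0, 0], ![0, 0, 1, 0], ![0, 0, 0, 1]],
    ![![-1, 1, 0, 0], ![-1, 0, 1, 0], ![0, 0, 1, 0], ![0, 0, 0, 1]],
    ![![-1, 1, 0, 0], ![-1, 0, 1, 0], ![-2, 0, 1, 1], ![0, 0, 0, 1]],
    ![![-1, 1, 0, 0], ![-2, 1, 0, 1], ![-2, 0, 1, 1], ![0, 0, 0, 1]],
    ![![-1, 1, 0, 0], ![-1, 0, 1, 0], ![-2, 0, 1, 1], ![-2, 0, 1, 0]],
    ![![-1, 0, 0, 1], ![-2, 1, 0, 1], ![-2, 0, 1, 1], ![0, 0, 0, 1]],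
    ![![-1, 1, 0, 0], ![-2, 1, 0, 1], ![-2, 0, 1, 1], ![-2, 0, 1, 0]],
    ![![-1, 0, 0, 1], ![-2, 1, 0, 1], ![-2, 0, 1, 1], ![-2, 0, 1, 0]],
    ![![-1, 1, 0, 0], ![-2, 1, 0, 1], ![-4, 2, 0, 1], ![-2, 0, 1, 0]],
    ![![-1, 0, 0, 1], ![-2, 1, 0, 1], ![-4, 2, 0, 1], ![-2, 0, 1, 0]],
    ![![-1, 1, 0, 0], ![-3, 2, 0, 0], ![-4, 2, 0, 1], ![-2, 0, 1, 0]]]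

/-- The coefficients of `r` with respect to the base `simpleCoords k`. -/
def coeff (k : Fin 12) (j : Fin 4) (r : Fin 4 → ℤ) : ℤ := ∑ i, dualCoords k j i * r i

/-- The roots that are nonnegative combinations of the base `simpleCoords k`. -/
def chamberCoords (k : Fin 12) : Finset (Fin 4 → ℤ) :=
  {r ∈ rootCoords | ∀ j, 0 ≤ coeff k j r}

lemma simpleCoords_mem : ∀ k j, simpleCoords k j ∈ rootCoords := by decide +kernel

lemma coeff_simpleCoords : ∀ k i j, coeff k i (simpleCoords k j) = if i = j then 1 else 0 := by
  decide +kernel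

lemma sum_coeff_mul : ∀ k, ∀ r ∈ rootCoords, ∀ i,
    r i = ∑ j, coeff k j r * simpleCoords k j i := by decide +kernel

lemma coeff_sign : ∀ k, ∀ r ∈ rootCoords,
    ((∀ j, 0 ≤ coeff k j r) ∧ ∃ j, 0 < coeff k j r) ∨
    ((∀ j, coeff k j r ≤ 0) ∧ ∃ j, coeff k j r < 0) := by decide +kernel

lemma coeff_nonneg_of_compact : ∀ k, ∀ r ∈ rootCoords, (∀ i, 0 ≤ r i) → Even (r 0) →
    ∀ j, 0 ≤ coeff k j r := by decide +kernel

lemma compact_of_coeff_nonneg : ∀ k, ∀ r ∈ rootCoords, (∀ j, 0 ≤ coeff k j r) → Even (r 0) →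
    ∀ i, 0 ≤ r i := by decide +kernel

lemma filter_odd_injective :
    Function.Injective fun k => {r ∈ chamberCoords k | Odd (r 0)} := by
  unfold Function.Injective
  decide +kernel

/-- The positive system of the base `simpleCoords k`. -/
def chamber (k : Fin 12) : Set V := ofCoords '' chamberCoords k

lemma ofCoords_mem_chamber {k : Fin 12} {r : Fin 4 → ℤ} :
    ofCoords r ∈ chamber k ↔ r ∈ rootCoords ∧ ∀ j, 0 ≤ coeff k j r := by
  rw [chamber, ofCoords_injective.mem_set_image]
  simp [chamberCoords]

lemma chamber_subset (k : Fin 12) : chamber k ⊆ Δ := by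
  rintro _ ⟨r, hr, rfl⟩
  exact ofCoords_mem_Δ.2 (Finset.mem_filter.1 hr).1

lemma Δkp_subset_chamber (k : Fin 12) : Δkp ⊆ chamber k := by
  intro α hα
  obtain ⟨r, hr, rfl⟩ := exists_coords hα.1.1
  obtain ⟨-, h0, h1⟩ := ofCoords_mem_Δkp.1 hα
  exact ofCoords_mem_chamber.2 ⟨hr, coeff_nonneg_of_compact k r hr h0 h1⟩

lemma Δkp_inter_Δn : Δkp ∩ Δn = ∅ := by
  ext α
  simp only [Set.mem_inter_iff, Set.mem_empty_iff_false, iff_false, not_and]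
  intro hk hn
  obtain ⟨r, -, rfl⟩ := exists_coords hk.1.1
  exact Int.not_even_iff_odd.2 (ofCoords_mem_Δn.1 hn).2 (ofCoords_mem_Δkp.1 hk).2.2

lemma Δkp_union_chamber_inter (k : Fin 12) : Δkp ∪ chamber k ∩ Δn = chamber k := by
  refine Set.Subset.antisymm
    (Set.union_subset (Δkp_subset_chamber k) Set.inter_subset_left) fun α hα => ?_
  obtain ⟨r, hr, rfl⟩ := exists_coords (chamber_subset k hα)
  rcases Int.even_or_odd (r 0) with h | h
  · exact Or.inl (ofCoords_mem_Δkp.2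
      ⟨hr, compact_of_coeff_nonneg k r hr (ofCoords_mem_chamber.1 hα).2 h, h⟩)
  · exact Or.inr ⟨hα, ofCoords_mem_Δn.2 ⟨hr, h⟩⟩

lemma chamber_inter_injective : Function.Injective fun k => chamber k ∩ Δn := by
  intro k l h
  refine filter_odd_injective (Finset.ext fun r => ?_)
  have := Set.ext_iff.1 h (ofCoords r)
  simp only [Set.mem_inter_iff, ofCoords_mem_chamber, ofCoords_mem_Δn] at this
  simp only [chamberCoords, Finset.mem_filter]
  tauto

/-! ### Coefficients of vectors in the twelve bases -/

/-- The linear functional `coeff k j`, extended to `V`. -/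
def coeffLM (k : Fin 12) (j : Fin 4) : V →ₗ[ℝ] ℝ where
  toFun v := ∑ i, (dualCoords k j i : ℝ) * n v i
  map_add' v w := by
    simp [n, Fin.sum_univ_four]
    ring
  map_smul' a v := by
    simp [n, Fin.sum_univ_four]
    ring

lemma coeffLM_ofCoords (k : Fin 12) (j : Fin 4) (r : Fin 4 → ℤ) :
    coeffLM k j (ofCoords r) = coeff k j r := by
  simp [coeffLM, coeff, n_ofCoords]

/-- The members of the base `simpleCoords k`. -/
def simpleRoot (k : Fin 12) (j : Fin 4) : V := ofCoords (simpleCoords k j)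

lemma coeffLM_simpleRoot (k : Fin 12) (i j : Fin 4) :
    coeffLM k i (simpleRoot k j) = if i = j then 1 else 0 := by
  rw [simpleRoot, coeffLM_ofCoords, coeff_simpleCoords]
  split_ifs <;> simp

lemma linearIndependent_simpleRoot (k : Fin 12) : LinearIndependent ℝ (simpleRoot k) := by
  rw [Fintype.linearIndependent_iff]
  intro g hg i
  have := congrArg (coeffLM k i) hg
  simpa [coeffLM_simpleRoot] using this

lemma ofCoords_eq_sum (k : Fin 12) {r : Fin 4 → ℤ} (hr : r ∈ rootCoords) :
    ofCoords r = ∑ j, (coeff k j r : ℝ) • simpleRoot k j := by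
  have h (i : Fin 4) : (r i : ℝ) = ∑ j, (coeff k j r : ℝ) * simpleCoords k j i := by
    exact_mod_cast sum_coeff_mul k r hr i
  simp only [simpleRoot, ofCoords, Finset.smul_sum, smul_smul]
  rw [Finset.sum_comm]
  simp only [← Finset.sum_smul, ← h]

/-- The base `simpleCoords k` as a finite set of vectors. -/
def base (k : Fin 12) : Finset V := Finset.univ.image (simpleRoot k)

lemma simpleRoot_mem_base (k : Fin 12) (j : Fin 4) : simpleRoot k j ∈ base k :=
  Finset.mem_image_of_mem _ (Finset.mem_univ j)

lemma forall_mem_base {k : Fin 12} {p : V → Prop} :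
    (∀ x ∈ base k, p x) ↔ ∀ j, p (simpleRoot k j) := by simp [base]

lemma sum_base (k : Fin 12) (c : V → ℤ) :
    ∑ x ∈ base k, (c x : ℝ) • x = ∑ j, (c (simpleRoot k j) : ℝ) • simpleRoot k j :=
  Finset.sum_image fun _ _ _ _ h => (linearIndependent_simpleRoot k).injective h

lemma coeff_eq_of_sum {k : Fin 12} {r : Fin 4 → ℤ} {c : V → ℤ}
    (h : ofCoords r = ∑ x ∈ base k, (c x : ℝ) • x) (j : Fin 4) :
    c (simpleRoot k j) = coeff k j r := by
  rw [sum_base] at h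
  have := congrArg (coeffLM k j) h
  simp only [coeffLM_ofCoords, map_sum, map_smul, coeffLM_simpleRoot] at this
  simpa using this.symm

lemma exists_coeff (k : Fin 12) {r : Fin 4 → ℤ} (hr : r ∈ rootCoords) : ∃ c : V → ℤ,
    ofCoords r = ∑ x ∈ base k, (c x : ℝ) • x ∧ ∀ j, c (simpleRoot k j) = coeff k j r := by
  let c : V → ℤ := Function.extend (simpleRoot k) (fun j => coeff k j r) 0
  have hc (j : Fin 4) : c (simpleRoot k j) = coeff k j r :=
    (linearIndependent_simpleRoot k).injective.extend_apply _ _ j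
  exact ⟨c, by simp only [sum_base, hc, ← ofCoords_eq_sum k hr], hc⟩

lemma isBase_base (k : Fin 12) : IsBase (base k) := by
  refine ⟨fun x hx => ?_, ?_, fun α hα => ?_⟩
  · obtain ⟨j, -, rfl⟩ := Finset.mem_image.1 hx
    exact ofCoords_mem_Δ.2 (simpleCoords_mem k j)
  · have h := (linearIndependent_simpleRoot k).linearIndepOn_id
    have hB : Set.range (simpleRoot k) = (base k : Set V) := by simp [base]
    rw [hB] at h
    exact h
  · obtain ⟨r, hr, rfl⟩ := exists_coords hα
    obtain ⟨c, h, hc⟩ := exists_coeff k hr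
    refine ⟨c, h, ?_⟩
    simp only [forall_mem_base, hc]
    exact (coeff_sign k r hr).imp And.left And.left

lemma posOf_base (k : Fin 12) : posOf (base k) = chamber k := by
  ext α
  constructor
  · rintro ⟨hα, c, h, hc⟩
    obtain ⟨r, hr, rfl⟩ := exists_coords hα
    exact ofCoords_mem_chamber.2 ⟨hr, fun j => coeff_eq_of_sum h j ▸ forall_mem_base.1 hc j⟩
  · intro hα
    obtain ⟨r, hr, rfl⟩ := exists_coords (chamber_subset k hα)
    obtain ⟨c, h, hc⟩ := exists_coeff k hr
    exact ⟨chamber_subset k hα, c, h, forall_mem_base.2 fun j =>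
      hc j ▸ (ofCoords_mem_chamber.1 hα).2 j⟩

lemma SBG_base (k : Fin 12) : SBG (base k) (base k) = chamber k ∩ Δn := by
  ext α
  constructor
  · rintro ⟨hα, c, h, x, hx, hpos⟩
    obtain ⟨r, hr, rfl⟩ := exists_coords hα.1
    obtain ⟨j, -, rfl⟩ := Finset.mem_image.1 hx
    rw [coeff_eq_of_sum h] at hpos
    refine ⟨ofCoords_mem_chamber.2 ⟨hr, ?_⟩, hα⟩
    rcases coeff_sign k r hr with h | h
    · exact h.1
    · exact absurd (h.1 j) hpos.not_ge
  · rintro ⟨hα, hn⟩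
    obtain ⟨r, hr, rfl⟩ := exists_coords hn.1
    obtain ⟨c, h, hc⟩ := exists_coeff k hr
    refine ⟨hn, c, h, ?_⟩
    rcases coeff_sign k r hr with ⟨-, j, hj⟩ | ⟨-, j, hj⟩
    · exact ⟨_, simpleRoot_mem_base k j, by rwa [hc]⟩
    · exact absurd ((ofCoords_mem_chamber.1 hα).2 j) hj.not_ge

/-! ### Positive systems containing `Δkp` -/

/-- A functional that is positive on the base `simpleCoords k` has `chamber k` as its set of
positive roots. -/
lemma setOf_pos_eq_chamber {k : Fin 12} {f : V →ₗ[ℝ] ℝ} (hf : ∀ j, 0 < f (simpleRoot k j)) :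
    (∀ α ∈ Δ, f α ≠ 0) ∧ {α ∈ Δ | 0 < f α} = chamber k := by
  have key {r : Fin 4 → ℤ} (hr : r ∈ rootCoords) :
      ((∀ j, 0 ≤ coeff k j r) ∧ 0 < f (ofCoords r)) ∨
      ((¬ ∀ j, 0 ≤ coeff k j r) ∧ f (ofCoords r) < 0) := by
    have hsum : f (ofCoords r) = ∑ j, (coeff k j r : ℝ) * f (simpleRoot k j) := by
      rw [ofCoords_eq_sum k hr]
      simp
    rw [hsum]
    rcases coeff_sign k r hr with ⟨h, j, hj⟩ | ⟨h, j, hj⟩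
    · exact Or.inl ⟨h, Finset.sum_pos' (fun i _ => mul_nonneg (by exact_mod_cast h i) (hf i).le)
        ⟨j, Finset.mem_univ j, mul_pos (by exact_mod_cast hj) (hf j)⟩⟩
    · exact Or.inr ⟨fun h' => (h' j).not_gt hj, Finset.sum_neg'
        (fun i _ => mul_nonpos_of_nonpos_of_nonneg (by exact_mod_cast h i) (hf i).le)
        ⟨j, Finset.mem_univ j, mul_neg_of_neg_of_pos (by exact_mod_cast hj) (hf j)⟩⟩
  constructor
  · intro α hα
    obtain ⟨r, hr, rfl⟩ := exists_coords hα
    rcases key hr with h | h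
    · exact h.2.ne'
    · exact h.2.ne
  · ext α
    constructor
    · rintro ⟨hα, hpos⟩
      obtain ⟨r, hr, rfl⟩ := exists_coords hα
      rcases key hr with h | h
      · exact ofCoords_mem_chamber.2 ⟨hr, h.1⟩
      · exact absurd h.2 hpos.not_gt
    · intro hα
      obtain ⟨r, hr, rfl⟩ := exists_coords (chamber_subset k hα)
      rcases key hr with h | h
      · exact ⟨ofCoords_mem_Δ.2 hr, h.2⟩
      · exact absurd (ofCoords_mem_chamber.1 hα).2 h.1

lemma isPosSystem_chamber (k : Fin 12) : IsPosSystem (chamber k) := by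
  have h : ∀ j, 0 < (∑ i, coeffLM k i) (simpleRoot k j) := fun j => by
    simp [LinearMap.sum_apply, coeffLM_simpleRoot]
  obtain ⟨h0, h1⟩ := setOf_pos_eq_chamber h
  exact ⟨_, h0, h1.symm⟩

lemma map_ofCoords (f : V →ₗ[ℝ] ℝ) (r : Fin 4 → ℤ) :
    f (ofCoords r) = r 0 * f φ₁ + r 1 * f φ₂ + r 2 * f φ₃ + r 3 * f φ₄ := by
  simp [ofCoords, Fin.sum_univ_four, φv]

lemma exists_simpleRoot_pos {f : V →ₗ[ℝ] ℝ} (hf : ∀ α ∈ Δ, f α ≠ 0)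
    (hk : ∀ α ∈ Δkp, 0 < f α) : ∃ k, ∀ j, 0 < f (simpleRoot k j) := by
  have split (r : Fin 4 → ℤ) (hr : r ∈ rootCoords) :
      0 < f (ofCoords r) ∨ f (ofCoords r) < 0 := (hf _ (ofCoords_mem_Δ.2 hr)).symm.lt_or_gt
  have pos (r : Fin 4 → ℤ) (hr : r ∈ rootCoords ∧ (∀ i, 0 ≤ r i) ∧ Even (r 0)) :
      0 < f (ofCoords r) := hk _ (ofCoords_mem_Δkp.2 hr)
  have h2 := pos ![0, 1, 0, 0] (by decide +kernel)
  have h3 := pos ![0, 0, 1, 0] (by decide +kernel)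
  have h4 := pos ![0, 0, 0, 1] (by decide +kernel)
  have hδ := pos ![2, 3, 4, 2] (by decide +kernel)
  have s1111 := split ![1, 1, 1, 1] (by decide +kernel)
  have s1110 := split ![1, 1, 1, 0] (by decide +kernel)
  have s1000 := split ![1, 0, 0, 0] (by decide +kernel)
  have s1100 := split ![1, 1, 0, 0] (by decide +kernel)
  have s1120 := split ![1, 1, 2, 0] (by decide +kernel)
  have s1220 := split ![1, 2, 2, 0] (by decide +kernel)
  have s1121 := split ![1, 1, 2, 1] (by decide +kernel)
  have s1122 := split ![1, 1, 2, 2] (by decide +kernel)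
  simp only [simpleRoot, map_ofCoords] at *
  simp only [Fin.forall_fin_succ]
  rcases s1111 with h1111 | h1111
  · rcases s1110 with h1110 | h1110
    · rcases s1000 with h1000 | h1000
      · exact ⟨0, by simp [simpleCoords] at *; refine ⟨?_, ?_, ?_, ?_⟩ <;> linarith⟩
      · rcases s1100 with h1100 | h1100
        · exact ⟨1, by simp [simpleCoords] at *; refine ⟨?_, ?_, ?_, ?_⟩ <;> linarith⟩
        · exact ⟨2, by simp [simpleCoords] at *; refine ⟨?_, ?_, ?_, ?_⟩ <;> linarith⟩
    · rcases s1120 with h1120 | h1120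
      · exact ⟨3, by simp [simpleCoords] at *; refine ⟨?_, ?_, ?_, ?_⟩ <;> linarith⟩
      · rcases s1220 with h1220 | h1220
        · exact ⟨4, by simp [simpleCoords] at *; refine ⟨?_, ?_, ?_, ?_⟩ <;> linarith⟩
        · exact ⟨6, by simp [simpleCoords] at *; refine ⟨?_, ?_, ?_, ?_⟩ <;> linarith⟩
  · rcases s1121 with h1121 | h1121
    · rcases s1120 with h1120 | h1120
      · exact ⟨5, by simp [simpleCoords] at *; refine ⟨?_, ?_, ?_, ?_⟩ <;> linarith⟩
      · rcases s1220 with h1220 | h1220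
        · exact ⟨7, by simp [simpleCoords] at *; refine ⟨?_, ?_, ?_, ?_⟩ <;> linarith⟩
        · exact ⟨8, by simp [simpleCoords] at *; refine ⟨?_, ?_, ?_, ?_⟩ <;> linarith⟩
    · rcases s1122 with h1122 | h1122
      · rcases s1220 with h1220 | h1220
        · exact ⟨9, by simp [simpleCoords] at *; refine ⟨?_, ?_, ?_, ?_⟩ <;> linarith⟩
        · exact ⟨10, by simp [simpleCoords] at *; refine ⟨?_, ?_, ?_, ?_⟩ <;> linarith⟩
      · exact ⟨11, by simp [simpleCoords] at *; refine ⟨?_, ?_, ?_, ?_⟩ <;> linarith⟩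

/-- The positive systems containing `Δkp` are the twelve sets `chamber k`. -/
lemma exists_eq_chamber {P : Set V} (hP : IsPosSystem P) (hk : Δkp ⊆ P) :
    ∃ k, P = chamber k := by
  obtain ⟨f, hf, rfl⟩ := hP
  obtain ⟨k, h⟩ := exists_simpleRoot_pos hf fun α hα => (hk hα).2
  exact ⟨k, (setOf_pos_eq_chamber h).2⟩

lemma setOf_posSystem_inter :
    {S : Set V | ∃ P : Set V, IsPosSystem P ∧ Δkp ⊆ P ∧ S = P ∩ Δn} =
      Set.range fun k => chamber k ∩ Δn := by
  ext S
  constructor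
  · rintro ⟨P, hP, hk, rfl⟩
    obtain ⟨k, rfl⟩ := exists_eq_chamber hP hk
    exact ⟨k, rfl⟩
  · rintro ⟨k, rfl⟩
    exact ⟨_, isPosSystem_chamber k, Δkp_subset_chamber k, rfl⟩

lemma setOf_SBG_eq :
    {S : Set V | (∃ B Γ : Finset V,
        IsBase B ∧ Δkp ⊆ posOf B ∧ Γ ⊆ B ∧ S = SBG B Γ) ∧
      IsPosSystem (Δkp ∪ S)} =
    {S : Set V | ∃ P : Set V, IsPosSystem P ∧ Δkp ⊆ P ∧ S = P ∩ Δn} := by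
  ext S
  constructor
  · rintro ⟨⟨B, Γ, -, -, -, rfl⟩, hP⟩
    refine ⟨_, hP, Set.subset_union_left, ?_⟩
    rw [Set.union_inter_distrib_right, Δkp_inter_Δn, Set.empty_union]
    exact (Set.inter_eq_left.2 fun _ h => h.1).symm
  · rintro ⟨P, hP, hk, rfl⟩
    obtain ⟨k, rfl⟩ := exists_eq_chamber hP hk
    refine ⟨⟨base k, base k, isBase_base k, ?_, Finset.Subset.refl _, (SBG_base k).symm⟩, ?_⟩
    · rw [posOf_base]
      exact hk
    · rw [Δkp_union_chamber_inter]
      exact hP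

end F4

theorem stmt18 :
    {S : Set V | (∃ B Γ : Finset V,
        IsBase B ∧ Δkp ⊆ posOf B ∧ Γ ⊆ B ∧ S = SBG B Γ) ∧
      IsPosSystem (Δkp ∪ S)}.ncard = 12 ∧
    {S : Set V | (∃ B Γ : Finset V,
        IsBase B ∧ Δkp ⊆ posOf B ∧ Γ ⊆ B ∧ S = SBG B Γ) ∧
      IsPosSystem (Δkp ∪ S)} =
    {S : Set V | ∃ P : Set V, IsPosSystem P ∧ Δkp ⊆ P ∧ S = P ∩ Δn} := by
  refine ⟨?_, F4.setOf_SBG_eq⟩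
  rw [F4.setOf_SBG_eq, F4.setOf_posSystem_inter, ← Set.image_univ,
    Set.ncard_image_of_injective _ F4.chamber_inter_injective, Set.ncard_univ, Nat.card_fin]
end
end
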